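/- Fix integers q ≥ 1 and m ≥ 1, and scalings K_n ≤ P_n (positive integers) and p_n ∈ (0,1] with K_n²/P_n → 0 as n → ∞. For each n, let S_1*, …, S_m* be arbitrary K_n-element subsets of a key pool of size P_n, let S be a uniformly random K_n-element subset of the pool and C_1, …, C_m independent Bernoulli(p_n) variables (independent of S); say w is linked to v_i iff |S ∩ S_i*| ≥ q and C_i = 1. Then for all sufficiently large n (uniformly over all choices of S_1*,…,S_m*) and every i ∈ {1,…,m}: the probability that w is linked to v_i and to no other v_j (j ≠ i) is at least p_{e,q}(n)·[1 − (q+2)!·m·p_{e,q}(n)^{1/q} − (p_n/K_n)·Σ_{j∈{1,…,m}\{i}} |S_i* ∩ S_j*|], where p_{e,q}(n) = p_n·(1 − Σ_{u=0}^{q−1} [C(K_n,u)·C(P_n−K_n,K_n−u)/C(P_n,K_n)]). -/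

import Mathlib

open Finset Filter

/-- A configuration for a single node `w`: its random key ring together with
the on/off states of the `m` channels from `w` to `v_1, …, v_m`. -/
abbrev WConfig (P m : ℕ) : Type := Finset (Fin P) × (Fin m → Bool)

/-- Probability weight: the key ring of `w` is uniform over the `K`-element
subsets of the pool of size `P`; the channels are independent Bernoulli(`p`). -/
noncomputable def wweight (K P m : ℕ) (p : ℝ) (ω : WConfig P m) : ℝ :=
  (if ω.1.card = K then ((P.choose K : ℝ))⁻¹ else 0) *
  ∏ i : Fin m, if ω.2 i then p else 1 - p

/-- Probability of an event. -/
noncomputable def wprob (K P m : ℕ) (p : ℝ) (E : Set (WConfig P m)) : ℝ :=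
  ∑ ω : WConfig P m, Set.indicator E (wweight K P m p) ω

/-- `w` is linked to `v_i` iff its key ring shares at least `q` keys with
`S_i*` and the channel to `v_i` is on. -/
def Linked (q P m : ℕ) (Sstar : Fin m → Finset (Fin P)) (ω : WConfig P m)
    (i : Fin m) : Prop :=
  q ≤ (ω.1 ∩ Sstar i).card ∧ ω.2 i = true

/-- `p_{s,q}`: the probability that two key rings share at least `q` keys. -/
noncomputable def psq (q K P : ℕ) : ℝ :=
  1 - ∑ u ∈ Finset.range q,
    ((K.choose u : ℝ) * ((P - K).choose (K - u) : ℝ)) / (P.choose K : ℝ)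

/-- `p_{e,q}`: the probability of a secure link. -/
noncomputable def peq (q K P : ℕ) (p : ℝ) : ℝ := p * psq q K P

section HypergeometricCounting

variable {P : ℕ}

/-- The `K`-subsets of the pool meeting `A` in at least `q` points. -/
def overlapRings (q K : ℕ) (A : Finset (Fin P)) : Finset (Finset (Fin P)) :=
  (powersetCard K univ).filter fun S => q ≤ (S ∩ A).card

lemma card_filter_inter_card_eq (K x : ℕ) (A : Finset (Fin P)) (hx : x ≤ K) :
    ((powersetCard K (univ : Finset (Fin P))).filter fun S => (S ∩ A).card = x).card =
      A.card.choose x * (P - A.card).choose (K - x) := by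
  have hcompl : Aᶜ.card = P - A.card := by simp [card_compl]
  rw [← hcompl, ← card_powersetCard, ← card_powersetCard, ← card_product]
  refine card_bij' (fun S _ => (S ∩ A, S ∩ Aᶜ)) (fun T _ => T.1 ∪ T.2) ?_ ?_ ?_ ?_
  · intro S hS
    simp only [mem_filter, mem_powersetCard_univ] at hS
    simp only [mem_product, mem_powersetCard]
    refine ⟨⟨inter_subset_right, hS.2⟩, inter_subset_right, ?_⟩
    have h := card_inter_add_card_sdiff S A
    rw [sdiff_eq_inter_compl] at h
    omega
  · rintro ⟨T, U⟩ hT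
    simp only [mem_product, mem_powersetCard] at hT
    obtain ⟨⟨hTA, hTc⟩, hUA, hUc⟩ := hT
    have hd : Disjoint U A := by
      rw [← subset_compl_iff_disjoint_right]; exact hUA
    simp only [mem_filter, mem_powersetCard_univ]
    constructor
    · rw [card_union_of_disjoint (hd.mono_right hTA).symm]; omega
    · rw [union_inter_distrib_right, inter_eq_left.2 hTA, disjoint_iff_inter_eq_empty.1 hd,
        union_empty, hTc]
  · intro S _
    simp only
    rw [← inter_union_distrib_left, union_compl, inter_univ]
  · rintro ⟨T, U⟩ hT
    simp only [mem_product, mem_powersetCard] at hT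
    obtain ⟨⟨hTA, hTc⟩, hUA, hUc⟩ := hT
    ext a
    · have h1 := @hTA a
      have h2 := @hUA a
      simp only [mem_compl] at h2
      simp only [mem_inter, mem_union]
      tauto
    · have h1 := @hTA a
      have h2 := @hUA a
      simp only [mem_compl] at h2
      simp only [mem_inter, mem_union, mem_compl]
      tauto

lemma inter_card_le {K : ℕ} {S A : Finset (Fin P)} (hA : A.card = K) : (S ∩ A).card ≤ K :=
  hA ▸ card_le_card inter_subset_right

lemma sum_overlapRings (q K : ℕ) (A : Finset (Fin P)) (hA : A.card = K) (f : ℕ → ℕ) :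
    ∑ S ∈ overlapRings q K A, f (S ∩ A).card =
      ∑ x ∈ Ico q (K + 1), f x * (K.choose x * (P - K).choose (K - x)) := by
  rw [← sum_fiberwise_of_maps_to (s := overlapRings q K A) (t := Ico q (K + 1))
    (g := fun S => (S ∩ A).card)]
  · refine sum_congr rfl fun x hx => ?_
    rw [mem_Ico] at hx
    rw [← hA, ← card_filter_inter_card_eq A.card x A (by omega), mul_comm, ← smul_eq_mul,
      ← sum_const]
    refine sum_congr ?_ ?_
    · ext S
      simp only [overlapRings, mem_filter]
      constructor
      · rintro ⟨⟨h1, _⟩, h3⟩; exact ⟨h1, h3⟩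
      · rintro ⟨h1, h3⟩; exact ⟨⟨h1, by omega⟩, h3⟩
    · intro S hS
      rw [(mem_filter.1 hS).2]
  · intro S hS
    simp only [overlapRings, mem_filter] at hS
    have := inter_card_le (S := S) hA
    rw [mem_Ico]; omega

lemma card_overlapRings (q K : ℕ) (A : Finset (Fin P)) (hA : A.card = K) :
    (overlapRings q K A).card =
      ∑ x ∈ Ico q (K + 1), K.choose x * (P - K).choose (K - x) := by
  simpa using sum_overlapRings q K A hA fun _ => 1

lemma psq_eq_card_div (q K : ℕ) (hKP : K ≤ P) (A : Finset (Fin P)) (hA : A.card = K) :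
    psq q K P = (overlapRings q K A).card / (P.choose K : ℝ) := by
  have hC : (P.choose K : ℝ) ≠ 0 := by
    exact_mod_cast (Nat.choose_pos hKP).ne'
  have hsplit : (overlapRings q K A).card +
      ∑ u ∈ range q, K.choose u * (P - K).choose (K - u) = P.choose K := by
    have htot : (overlapRings 0 K A).card = P.choose K := by
      simp [overlapRings]
    rw [← htot, card_overlapRings _ _ _ hA, card_overlapRings _ _ _ hA]
    rcases le_or_gt q (K + 1) with h | h
    · rw [add_comm, range_eq_Ico]
      exact sum_Ico_consecutive _ (Nat.zero_le _) h
    · rw [Ico_eq_empty (by omega), sum_empty, zero_add, range_eq_Ico]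
      rw [← sum_Ico_consecutive _ (Nat.zero_le _) h.le]
      rw [Nat.add_eq_left]
      refine sum_eq_zero fun x hx => ?_
      rw [mem_Ico] at hx
      rw [Nat.choose_eq_zero_of_lt (by omega), zero_mul]
  rw [psq, eq_div_iff hC, sub_mul, ← sum_div, div_mul_cancel₀ _ hC, ← hsplit]
  push_cast
  ring

lemma hypergeometric_ratio_le (K x : ℕ) (hKP : 2 * K ≤ P) (hx : x < K) :
    (x + 1) * (K.choose (x + 1) * (P - K).choose (K - (x + 1))) * (P - 2 * K) ≤
      K ^ 2 * (K.choose x * (P - K).choose (K - x)) := by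
  obtain ⟨k, rfl⟩ : ∃ k, K = x + 1 + k := ⟨K - (x + 1), by omega⟩
  have h1 := Nat.choose_succ_right_eq (x + 1 + k) x
  have h2 := Nat.choose_succ_right_eq (P - (x + 1 + k)) k
  rw [show x + 1 + k - (x + 1) = k by omega, show x + 1 + k - x = k + 1 by omega]
  rw [show x + 1 + k - x = k + 1 by omega] at h1
  calc _ = ((x + 1 + k).choose (x + 1) * (x + 1)) *
        ((P - (x + 1 + k)).choose k * (P - 2 * (x + 1 + k))) := by ring
    _ ≤ ((x + 1 + k).choose (x + 1) * (x + 1)) *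
        ((P - (x + 1 + k)).choose k * (P - (x + 1 + k) - k)) :=
      Nat.mul_le_mul_left _ (Nat.mul_le_mul_left _ (by omega))
    _ = (k + 1) ^ 2 *
        ((x + 1 + k).choose x * (P - (x + 1 + k)).choose (k + 1)) := by
      rw [← h2, h1]; ring
    _ ≤ _ := Nat.mul_le_mul_right _ (Nat.pow_le_pow_left (by omega) 2)

lemma sum_inter_card_overlapRings_le (q K : ℕ) (hKP : 2 * K ≤ P) (A : Finset (Fin P))
    (hA : A.card = K) :
    (∑ S ∈ overlapRings q K A, (S ∩ A).card) * (P - 2 * K) ≤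
      (q * (P - 2 * K) + K ^ 2) * (overlapRings q K A).card := by
  rcases le_or_gt q K with hq | hq
  · rw [sum_overlapRings q K A hA fun x => x, card_overlapRings q K A hA]
    set h : ℕ → ℕ := fun x => K.choose x * (P - K).choose (K - x) with hh
    change (∑ x ∈ Ico q (K + 1), x * h x) * _ ≤ _ * ∑ x ∈ Ico q (K + 1), h x
    have hshift : ∑ x ∈ Ico (q + 1) (K + 1), x * h x = ∑ x ∈ Ico q K, (x + 1) * h (x + 1) :=
      (sum_Ico_add' (fun x => x * h x) q K 1).symm
    have hhead : h q ≤ ∑ x ∈ Ico q (K + 1), h x :=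
      single_le_sum (f := h) (fun _ _ => Nat.zero_le _) (by rw [mem_Ico]; omega)
    have htail : (∑ x ∈ Ico q K, (x + 1) * h (x + 1)) * (P - 2 * K) ≤
        K ^ 2 * ∑ x ∈ Ico q (K + 1), h x := by
      calc _ = ∑ x ∈ Ico q K, (x + 1) * h (x + 1) * (P - 2 * K) := sum_mul ..
        _ ≤ ∑ x ∈ Ico q K, K ^ 2 * h x :=
          sum_le_sum fun x hx => hypergeometric_ratio_le K x hKP (mem_Ico.1 hx).2
        _ = K ^ 2 * ∑ x ∈ Ico q K, h x := (mul_sum ..).symm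
        _ ≤ _ := by
          gcongr
          omega
    rw [sum_eq_sum_Ico_succ_bot (by omega), hshift, add_mul, add_mul]
    refine add_le_add ?_ htail
    rw [mul_right_comm]
    exact Nat.mul_le_mul_left _ hhead
  · have : overlapRings q K A = ∅ := by
      refine filter_eq_empty_iff.2 fun S _ => ?_
      have := inter_card_le (S := S) hA
      omega
    simp [this]

lemma card_filter_mem_overlapRings_eq (q K : ℕ) (A : Finset (Fin P)) {y z : Fin P}
    (hyz : y ∈ A ↔ z ∈ A) :
    ((overlapRings q K A).filter (y ∈ ·)).card = ((overlapRings q K A).filter (z ∈ ·)).card := by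
  have hmapA : A.map (Equiv.swap y z).toEmbedding = A := by
    ext a
    rw [mem_map_equiv, Equiv.symm_swap]
    by_cases h1 : a = y
    · subst h1; rw [Equiv.swap_apply_left]; exact hyz.symm
    · by_cases h2 : a = z
      · subst h2; rw [Equiv.swap_apply_right]; exact hyz
      · rw [Equiv.swap_apply_of_ne_of_ne h1 h2]
  have hmem : ∀ S ∈ overlapRings q K A,
      S.map (Equiv.swap y z).toEmbedding ∈ overlapRings q K A := by
    intro S hS
    simp only [overlapRings, mem_filter, mem_powersetCard_univ] at hS ⊢
    refine ⟨by rw [card_map]; exact hS.1, ?_⟩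
    have : S.map (Equiv.swap y z).toEmbedding ∩ A = (S ∩ A).map (Equiv.swap y z).toEmbedding := by
      rw [map_inter, hmapA]
    rw [this, card_map]
    exact hS.2
  have hinv : ∀ S : Finset (Fin P), (S.map (Equiv.swap y z).toEmbedding).map
      (Equiv.swap y z).toEmbedding = S := by
    intro S
    ext a
    simp [mem_map_equiv]
  refine card_bij' (fun S _ => S.map (Equiv.swap y z).toEmbedding)
    (fun S _ => S.map (Equiv.swap y z).toEmbedding) ?_ ?_ (fun S _ => hinv S) (fun S _ => hinv S)
  · intro S hS
    rw [mem_filter] at hS ⊢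
    refine ⟨hmem S hS.1, ?_⟩
    rw [mem_map_equiv, Equiv.symm_swap, Equiv.swap_apply_right]
    exact hS.2
  · intro S hS
    rw [mem_filter] at hS ⊢
    refine ⟨hmem S hS.1, ?_⟩
    rw [mem_map_equiv, Equiv.symm_swap, Equiv.swap_apply_left]
    exact hS.2

lemma sum_inter_card_eq (F : Finset (Finset (Fin P))) (B : Finset (Fin P)) :
    ∑ S ∈ F, (S ∩ B).card = ∑ y ∈ B, (F.filter (y ∈ ·)).card := by
  simp_rw [card_filter]
  rw [sum_comm]
  refine sum_congr rfl fun S _ => ?_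
  rw [← card_filter, inter_comm, filter_mem_eq_inter]

lemma card_mul_card_filter_mem (q K : ℕ) (A B : Finset (Fin P))
    (hB : ∀ y ∈ B, ∀ z ∈ B, (y ∈ A ↔ z ∈ A)) {y : Fin P} (hy : y ∈ B) :
    B.card * ((overlapRings q K A).filter (y ∈ ·)).card =
      ∑ S ∈ overlapRings q K A, (S ∩ B).card := by
  rw [sum_inter_card_eq, ← smul_eq_mul, ← sum_const]
  exact sum_congr rfl fun z hz => card_filter_mem_overlapRings_eq q K A (hB y hy z hz)

/-- The number of key rings overlapping both `A` and `B` in at least `q` keys is controlled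
by the number of those overlapping `A` alone. -/
lemma card_overlapRings_both_le (q K : ℕ) (hq : 1 ≤ q) (hK : 1 ≤ K) (hKP : 2 * K < P)
    (A B : Finset (Fin P)) (hA : A.card = K) (hB : B.card = K) :
    (((overlapRings q K A).filter fun S => q ≤ (S ∩ B).card).card : ℝ) ≤
      (overlapRings q K A).card *
        ((A ∩ B).card / (K : ℝ) + (K : ℝ) ^ 2 / ((P : ℝ) - 2 * K) / q) := by
  set F := overlapRings q K A with hF
  set M := (F.filter fun S => q ≤ (S ∩ B).card).card with hM
  set c := (A ∩ B).card with hc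
  have hq0 : (0 : ℝ) < q := by exact_mod_cast hq
  have hK0 : (0 : ℝ) < K := by exact_mod_cast hK
  have hP0 : (0 : ℝ) < (P : ℝ) - 2 * K := by
    have : (2 * K : ℝ) < P := by exact_mod_cast hKP
    linarith
  set r : ℝ := (K : ℝ) ^ 2 / ((P : ℝ) - 2 * K) with hr
  have hmarkov : q * M ≤ ∑ S ∈ F, (S ∩ B).card := by
    calc q * M = ∑ S ∈ F.filter (fun S => q ≤ (S ∩ B).card), q := by
          rw [sum_const, smul_eq_mul, mul_comm]
      _ ≤ ∑ S ∈ F.filter (fun S => q ≤ (S ∩ B).card), (S ∩ B).card :=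
          sum_le_sum fun S hS => (mem_filter.1 hS).2
      _ ≤ _ := sum_le_sum_of_subset (filter_subset _ _)
  have hinside : ∀ y ∈ B ∩ A, ((F.filter (y ∈ ·)).card : ℝ) ≤ F.card * ((q + r) / K) := by
    intro y hy
    have h1 := card_mul_card_filter_mem q K A A (fun y hy z hz => by simp [hy, hz])
      (mem_of_mem_inter_right hy)
    have h2 := sum_inter_card_overlapRings_le q K hKP.le A hA
    rw [← h1, hA, ← hF] at h2
    have h3 : (K : ℝ) * (F.filter (y ∈ ·)).card * ((P : ℝ) - 2 * K) ≤
        (q * ((P : ℝ) - 2 * K) + (K : ℝ) ^ 2) * F.card := by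
      have : ((P - 2 * K : ℕ) : ℝ) = (P : ℝ) - 2 * K := by
        rw [Nat.cast_sub hKP.le]; push_cast; ring
      rw [← this]
      exact_mod_cast h2
    have h4 : (q * ((P : ℝ) - 2 * K) + (K : ℝ) ^ 2) = (q + r) * ((P : ℝ) - 2 * K) := by
      rw [hr]; field_simp
    rw [h4] at h3
    rw [← mul_div_assoc, le_div_iff₀ hK0]
    refine le_of_mul_le_mul_right ?_ hP0
    linarith
  have houtside : ∀ y ∈ B \ A, ((F.filter (y ∈ ·)).card : ℝ) ≤ F.card * (r / K) := by
    intro y hy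
    have h1 := card_mul_card_filter_mem q K A Aᶜ
      (fun y hy z hz => by simp [mem_compl.1 hy, mem_compl.1 hz])
      (mem_compl.2 (mem_sdiff.1 hy).2)
    have h2 : ∑ S ∈ F, (S ∩ Aᶜ).card ≤ F.card * K := by
      rw [← smul_eq_mul]
      refine sum_le_card_nsmul _ _ _ fun S hS => ?_
      simp only [hF, overlapRings, mem_filter, mem_powersetCard_univ] at hS
      exact hS.1 ▸ card_le_card inter_subset_left
    have hcompl : Aᶜ.card = P - K := by simp [card_compl, hA]
    rw [← h1, hcompl, ← hF] at h2
    have h3 : ((P : ℝ) - K) * (F.filter (y ∈ ·)).card ≤ F.card * K := by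
      have : ((P - K : ℕ) : ℝ) = (P : ℝ) - K := Nat.cast_sub (by omega)
      rw [← this]
      exact_mod_cast h2
    have h4 : r / K = K / ((P : ℝ) - 2 * K) := by
      rw [hr]; field_simp
    rw [h4, ← mul_div_assoc, le_div_iff₀ hP0]
    have : (0 : ℝ) ≤ (F.filter (y ∈ ·)).card := Nat.cast_nonneg _
    nlinarith
  have hcard : ((B \ A).card : ℝ) = K - c := by
    have h := card_inter_add_card_sdiff B A
    rw [hB, inter_comm, ← hc] at h
    rw [eq_sub_iff_add_eq, add_comm]
    exact_mod_cast h
  have hbound : (q : ℝ) * M ≤ F.card * (c * q / K + r) := by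
    calc (q : ℝ) * M ≤ ((∑ S ∈ F, (S ∩ B).card : ℕ) : ℝ) := by exact_mod_cast hmarkov
      _ = ∑ y ∈ B, ((F.filter (y ∈ ·)).card : ℝ) := by
        rw [sum_inter_card_eq]; push_cast; rfl
      _ = ∑ y ∈ B ∩ A, ((F.filter (y ∈ ·)).card : ℝ) +
          ∑ y ∈ B \ A, ((F.filter (y ∈ ·)).card : ℝ) := (sum_inter_add_sum_sdiff B A _).symm
      _ ≤ ∑ y ∈ B ∩ A, F.card * ((q + r) / K) + ∑ y ∈ B \ A, F.card * (r / K) :=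
        add_le_add (sum_le_sum hinside) (sum_le_sum houtside)
      _ = c * (F.card * ((q + r) / K)) + (K - c) * (F.card * (r / K)) := by
        rw [sum_const, sum_const, nsmul_eq_mul, nsmul_eq_mul, hcard, hc, inter_comm]
      _ = _ := by field_simp; ring
  refine le_of_mul_le_mul_left (hbound.trans_eq ?_) hq0
  field_simp

end HypergeometricCounting

lemma choose_add_le (a b k : ℕ) :
    (a + b).choose (k + 1) ≤ a.choose (k + 1) + b * (a + b - 1).choose k := by
  induction b with
  | zero => simp
  | succ b ih =>
    have hmono : (a + b - 1).choose k ≤ (a + b).choose k := Nat.choose_le_choose k (by omega)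
    have hpascal : (a + (b + 1)).choose (k + 1) = (a + b).choose k + (a + b).choose (k + 1) := by
      rw [← add_assoc, Nat.choose_succ_succ]
    rw [hpascal, show a + (b + 1) - 1 = a + b by omega]
    nlinarith

lemma choose_le_two_mul_choose_sub (a b k : ℕ) (hb : b ≤ a) (h : 2 * (b * k) ≤ a) :
    a.choose k ≤ 2 * (a - b).choose k := by
  rcases k with _ | k
  · simp
  rcases a with _ | a
  · simp
  have h1 := choose_add_le (a + 1 - b) b k
  rw [Nat.sub_add_cancel hb, Nat.add_sub_cancel] at h1
  have h2 := Nat.add_one_mul_choose_eq a k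
  have h3 : 2 * (b * a.choose k) ≤ (a + 1).choose (k + 1) := by
    refine Nat.le_of_mul_le_mul_right ?_ (Nat.succ_pos k)
    calc 2 * (b * a.choose k) * (k + 1) = 2 * (b * (k + 1)) * a.choose k := by ring
      _ ≤ (a + 1) * a.choose k := by gcongr
      _ = _ := h2
  omega

lemma four_mul_sq_le_factorial (q : ℕ) (hq : 1 ≤ q) : 4 * q ^ 2 ≤ (q + 2).factorial := by
  induction q, hq using Nat.le_induction with
  | base => decide
  | succ q hq ih =>
    rw [show q + 1 + 2 = (q + 2) + 1 by ring, Nat.factorial_succ]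
    nlinarith

/-- A polynomial lower bound for the probability of sharing `q` keys. -/
lemma pow_le_psq (q K P : ℕ) (hq : 1 ≤ q) (hqK : q ≤ K) (hKP : 8 * K ^ 2 ≤ P) :
    ((K : ℝ) ^ 2 / (2 * q ^ 3 * P)) ^ q ≤ psq q K P := by
  have hK8 : 8 * K ≤ P := by nlinarith
  have hq0 : (0 : ℝ) < q := by exact_mod_cast hq
  have hP0 : (0 : ℝ) < P := by
    have : 0 < P := by omega
    exact_mod_cast this
  obtain ⟨A, -, hA⟩ := exists_subset_card_eq (s := (univ : Finset (Fin P))) (n := K)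
    (by simp; omega)
  have hCpos : (0 : ℝ) < P.choose K := by exact_mod_cast Nat.choose_pos (by omega)
  rw [psq_eq_card_div q K (by omega) A hA, le_div_iff₀ hCpos]
  have hN : K.choose q * (P - K).choose (K - q) ≤ (overlapRings q K A).card := by
    rw [card_overlapRings q K A hA]
    exact single_le_sum (f := fun x => K.choose x * (P - K).choose (K - x))
      (fun _ _ => Nat.zero_le _) (by rw [mem_Ico]; omega)
  have hhalf : (P - q).choose (K - q) ≤ 2 * (P - K).choose (K - q) := by
    have h := choose_le_two_mul_choose_sub (P - q) (K - q) (K - q) (by omega) (by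
      have : (K - q) * (K - q) ≤ K ^ 2 := by
        rw [sq]; exact Nat.mul_le_mul (Nat.sub_le _ _) (Nat.sub_le _ _)
      have : q ≤ P - 2 * K ^ 2 := by
        have : K ≤ K ^ 2 := by nlinarith
        omega
      omega)
    rwa [show P - q - (K - q) = P - K by omega] at h
  have hmul : P.choose K * K.choose q = P.choose q * (P - q).choose (K - q) :=
    Nat.choose_mul hqK
  have hPq : (P.choose q : ℝ) * q.factorial ≤ (P : ℝ) ^ q := by
    rw [← le_div_iff₀ (by positivity)]
    exact Nat.choose_le_pow_div q P
  have hfac : (q.factorial : ℝ) ≤ (q : ℝ) ^ q := by exact_mod_cast Nat.factorial_le_pow q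
  have hKq : ((K : ℝ) / q) ^ q ≤ q.factorial * K.choose q := by
    refine le_trans ?_ ((div_le_iff₀' (by positivity)).1 (Nat.pow_le_choose (α := ℝ) q K))
    gcongr
    rw [div_le_iff₀ hq0]
    have h1 : ((K + 1 - q : ℕ) : ℝ) = (K : ℝ) + 1 - q := by
      rw [Nat.cast_sub (by omega)]; push_cast; ring
    rw [h1]
    have h2 : (1 : ℝ) ≤ q := by exact_mod_cast hq
    have h3 : (q : ℝ) ≤ K := by exact_mod_cast hqK
    nlinarith
  set x : ℝ := (K : ℝ) ^ 2 / (2 * q ^ 3 * P) with hx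
  have hx0 : 0 ≤ x := by positivity
  have hpow : x ^ q * (P : ℝ) ^ q * (2 * q.factorial) ≤ (((K : ℝ) / q) ^ q) ^ 2 := by
    have h1 : ((K : ℝ) / q) ^ 2 = x * P * (2 * q) := by
      rw [hx]; field_simp
    have h2 : (2 : ℝ) ≤ 2 ^ q := le_self_pow₀ (by norm_num) (by omega)
    rw [← pow_mul, mul_comm q 2, pow_mul, h1, mul_pow, mul_pow, mul_pow]
    gcongr
  have hratio : x ^ q * (2 * P.choose q) ≤ (K.choose q : ℝ) ^ 2 := by
    have hf : (0 : ℝ) < (q.factorial : ℝ) ^ 2 := by positivity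
    refine le_of_mul_le_mul_left ?_ hf
    calc (q.factorial : ℝ) ^ 2 * (x ^ q * (2 * P.choose q))
        = x ^ q * (P.choose q * q.factorial) * (2 * q.factorial) := by ring
      _ ≤ x ^ q * (P : ℝ) ^ q * (2 * q.factorial) := by gcongr
      _ ≤ (((K : ℝ) / q) ^ q) ^ 2 := hpow
      _ ≤ (q.factorial * K.choose q) ^ 2 := by gcongr
      _ = _ := by ring
  have hKq0 : (0 : ℝ) < K.choose q := by exact_mod_cast Nat.choose_pos hqK
  refine le_trans ?_ (Nat.cast_le.2 hN)
  push_cast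
  refine le_of_mul_le_mul_right ?_ hKq0
  have hmul' : (P.choose K : ℝ) * K.choose q = P.choose q * (P - q).choose (K - q) := by
    exact_mod_cast hmul
  have hhalf' : ((P - q).choose (K - q) : ℝ) ≤ 2 * (P - K).choose (K - q) := by
    exact_mod_cast hhalf
  calc x ^ q * P.choose K * K.choose q = x ^ q * (P.choose q * (P - q).choose (K - q)) := by
        rw [← hmul', mul_assoc]
    _ ≤ x ^ q * (P.choose q * (2 * (P - K).choose (K - q))) := by gcongr
    _ = x ^ q * (2 * P.choose q) * (P - K).choose (K - q) := by ring
    _ ≤ (K.choose q : ℝ) ^ 2 * (P - K).choose (K - q) := by gcongr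
    _ = _ := by ring

lemma sq_div_le_factorial_mul_rpow (q K P : ℕ) (hq : 1 ≤ q) (hqK : q ≤ K)
    (hKP : 8 * K ^ 2 ≤ P) :
    (K : ℝ) ^ 2 / ((P : ℝ) - 2 * K) / q ≤
      ((q + 2).factorial : ℝ) * psq q K P ^ (1 / (q : ℝ)) := by
  have hK8 : 8 * K ≤ P := by nlinarith
  have hK8' : 8 * (K : ℝ) ≤ P := by exact_mod_cast hK8
  have hq0 : (0 : ℝ) < q := by exact_mod_cast hq
  have hK0 : (0 : ℝ) < K := by exact_mod_cast (by omega : 0 < K)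
  have hP0 : (0 : ℝ) < P := by linarith
  have hroot : (K : ℝ) ^ 2 / (2 * q ^ 3 * P) ≤ psq q K P ^ (1 / (q : ℝ)) := by
    have h := Real.rpow_le_rpow (by positivity) (pow_le_psq q K P hq hqK hKP)
      (by positivity : (0 : ℝ) ≤ 1 / q)
    rwa [one_div, Real.pow_rpow_inv_natCast (by positivity) (by omega), ← one_div] at h
  have hfac : (4 : ℝ) * q ^ 2 ≤ ((q + 2).factorial : ℝ) := by
    exact_mod_cast four_mul_sq_le_factorial q hq
  calc (K : ℝ) ^ 2 / ((P : ℝ) - 2 * K) / q ≤ (K : ℝ) ^ 2 / ((P : ℝ) / 2) / q := by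
        gcongr
        linarith
    _ = (4 * q ^ 2) * ((K : ℝ) ^ 2 / (2 * q ^ 3 * P)) := by field_simp; ring
    _ ≤ _ := by gcongr

section Channels

lemma sum_channel_weights {m : ℕ} (p : ℝ) (T : Finset (Fin m)) :
    ∑ c : Fin m → Bool, (if ∀ k ∈ T, c k = true then
      ∏ i : Fin m, (if c i then p else 1 - p) else 0) = p ^ T.card := by
  have h : ∀ c : Fin m → Bool, (if ∀ k ∈ T, c k = true then
      ∏ i : Fin m, (if c i then p else 1 - p) else 0) =
      ∏ i : Fin m, (if c i then p else if i ∈ T then 0 else 1 - p) := by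
    intro c
    split_ifs with hc
    · refine prod_congr rfl fun i _ => ?_
      by_cases hi : i ∈ T
      · simp [hc i hi]
      · simp [hi]
    · push Not at hc
      obtain ⟨k, hk, hck⟩ := hc
      exact (prod_eq_zero (mem_univ k) (by simp [hk, hck])).symm
  simp_rw [h]
  rw [← Fintype.prod_sum fun (i : Fin m) (b : Bool) =>
    if b then p else if i ∈ T then 0 else 1 - p]
  have h2 : ∀ i : Fin m, ∑ b : Bool, (if b then p else if i ∈ T then 0 else 1 - p) =
      if i ∈ T then p else 1 := by
    intro i
    by_cases hi : i ∈ T <;> simp [hi]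
  simp_rw [h2]
  rw [prod_ite_mem, univ_inter, prod_const]

open scoped Classical in
lemma wprob_keys_and_channels (K P m : ℕ) (p : ℝ) (Q : Finset (Fin P) → Prop)
    (T : Finset (Fin m)) :
    wprob K P m p {ω | Q ω.1 ∧ ∀ k ∈ T, ω.2 k = true} =
      ((powersetCard K univ).filter Q).card / (P.choose K : ℝ) * p ^ T.card := by
  rw [wprob, Fintype.sum_prod_type, ← sum_channel_weights p T]
  have h : ∀ (S : Finset (Fin P)) (c : Fin m → Bool),
      Set.indicator {ω : WConfig P m | Q ω.1 ∧ ∀ k ∈ T, ω.2 k = true} (wweight K P m p) (S, c) =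
      (if S.card = K ∧ Q S then ((P.choose K : ℝ))⁻¹ else 0) *
        (if ∀ k ∈ T, c k = true then ∏ i : Fin m, (if c i then p else 1 - p) else 0) := by
    intro S c
    by_cases h1 : S.card = K <;> by_cases h2 : Q S <;> by_cases h3 : ∀ k ∈ T, c k = true <;>
      simp [Set.indicator, wweight, h1, h2, h3]
  simp_rw [h]
  rw [← sum_mul_sum, ← sum_filter, sum_const, nsmul_eq_mul, div_eq_mul_inv]
  congr 3
  congr 1
  ext S
  simp

lemma wweight_nonneg (K P m : ℕ) {p : ℝ} (h0 : 0 ≤ p) (h1 : p ≤ 1) (ω : WConfig P m) :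
    0 ≤ wweight K P m p ω := by
  refine mul_nonneg (by split_ifs <;> positivity) (prod_nonneg fun i _ => ?_)
  split_ifs <;> linarith

lemma wprob_sub_sum_le (K P m : ℕ) {p : ℝ} (h0 : 0 ≤ p) (h1 : p ≤ 1)
    (L : Fin m → WConfig P m → Prop) (i : Fin m) :
    wprob K P m p {ω | L i ω} -
        ∑ j ∈ univ.filter (fun j : Fin m => j ≠ i), wprob K P m p {ω | L i ω ∧ L j ω} ≤
      wprob K P m p {ω | L i ω ∧ ∀ j, j ≠ i → ¬ L j ω} := by
  classical
  unfold wprob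
  rw [sum_comm, ← sum_sub_distrib]
  refine sum_le_sum fun ω _ => ?_
  have hw := wweight_nonneg K P m h0 h1 ω
  have hnn : ∀ j, 0 ≤ Set.indicator {ω | L i ω ∧ L j ω} (wweight K P m p) ω := fun j =>
    Set.indicator_apply_nonneg fun _ => hw
  by_cases hi : L i ω
  · by_cases hj : ∀ j, j ≠ i → ¬ L j ω
    · have := sum_nonneg fun j (_ : j ∈ univ.filter (fun j : Fin m => j ≠ i)) => hnn j
      simp only [Set.indicator, Set.mem_ofPred_eq, hi, true_and] at this ⊢
      rw [if_pos hj, if_true]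
      linarith
    · have hE : Set.indicator {ω | L i ω ∧ ∀ j, j ≠ i → ¬ L j ω} (wweight K P m p) ω = 0 :=
        Set.indicator_of_notMem (fun h => hj h.2) _
      rw [hE]
      push Not at hj
      obtain ⟨j, hji, hjL⟩ := hj
      have := single_le_sum (f := fun j =>
        Set.indicator {ω | L i ω ∧ L j ω} (wweight K P m p) ω) (fun j _ => hnn j)
        (show j ∈ univ.filter (fun j : Fin m => j ≠ i) from mem_filter.2 ⟨mem_univ j, hji⟩)
      simp only [Set.indicator, Set.mem_ofPred_eq, hi, hjL, true_and, if_true] at this ⊢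
      linarith
  · have hz : ∀ j, Set.indicator {ω | L i ω ∧ L j ω} (wweight K P m p) ω = 0 := fun j =>
      Set.indicator_of_notMem (fun h => hi h.1) _
    have hz' : Set.indicator {ω | L i ω} (wweight K P m p) ω = 0 :=
      Set.indicator_of_notMem hi _
    simp only [hz, hz', sum_const_zero, sub_zero]
    exact Set.indicator_apply_nonneg fun _ => hw

end Channels

/-- The lower bound for a single scaling point, once the pool is large compared to the rings. -/
lemma peq_mul_le_wprob (q m K P : ℕ) (p : ℝ) (hq : 1 ≤ q) (hK : 1 ≤ K)
    (h0 : 0 < p) (h1 : p ≤ 1) (hKP : 8 * K ^ 2 ≤ P)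
    (Sstar : Fin m → Finset (Fin P)) (hS : ∀ i, (Sstar i).card = K) (i : Fin m) :
    peq q K P p * (1 - ((q + 2).factorial : ℝ) * (m : ℝ) * peq q K P p ^ (1 / (q : ℝ))
        - p / (K : ℝ) * ∑ j ∈ univ.filter (fun j : Fin m => j ≠ i),
          ((Sstar i ∩ Sstar j).card : ℝ)) ≤
      wprob K P m p {ω | Linked q P m Sstar ω i ∧
        ∀ j : Fin m, j ≠ i → ¬ Linked q P m Sstar ω j} := by
  classical
  have hK8 : 8 * K ≤ P := by nlinarith
  have hCpos : (0 : ℝ) < P.choose K := by exact_mod_cast Nat.choose_pos (by omega)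
  have hpsq := psq_eq_card_div q K (by omega) (Sstar i) (hS i)
  have hpsq0 : 0 ≤ psq q K P := by rw [hpsq]; positivity
  have hpeq0 : 0 ≤ peq q K P p := mul_nonneg h0.le hpsq0
  have hq0 : (0 : ℝ) < q := by exact_mod_cast hq
  have hK0 : (0 : ℝ) < K := by exact_mod_cast hK
  rcases lt_or_ge K q with hKq | hqK
  · have hzero : peq q K P p = 0 := by
      rw [peq, hpsq, card_overlapRings q K _ (hS i), Ico_eq_empty (by omega)]
      simp
    rw [hzero, zero_mul]
    exact sum_nonneg fun ω _ => Set.indicator_apply_nonneg fun _ =>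
      wweight_nonneg K P m h0.le h1 ω
  have hsingle : wprob K P m p {ω | Linked q P m Sstar ω i} = peq q K P p := by
    have h := wprob_keys_and_channels K P m p (fun S => q ≤ (S ∩ Sstar i).card) {i}
    simp only [mem_singleton, forall_eq, card_singleton, pow_one] at h
    rw [peq, hpsq, mul_comm]
    calc _ = _ := h
      _ = _ := by
        rw [overlapRings]
        congr!
  have hroot : p * psq q K P ^ (1 / (q : ℝ)) ≤ peq q K P p ^ (1 / (q : ℝ)) := by
    rw [peq, Real.mul_rpow h0.le hpsq0]
    gcongr
    refine Real.self_le_rpow_of_le_one h0.le h1 ?_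
    rw [div_le_one hq0]
    exact_mod_cast hq
  have hpair : ∀ j ∈ univ.filter (fun j : Fin m => j ≠ i),
      wprob K P m p {ω | Linked q P m Sstar ω i ∧ Linked q P m Sstar ω j} ≤
        peq q K P p * (((q + 2).factorial : ℝ) * peq q K P p ^ (1 / (q : ℝ)) +
          p / K * (Sstar i ∩ Sstar j).card) := by
    intro j hj
    have hji : j ≠ i := (mem_filter.1 hj).2
    have h := wprob_keys_and_channels K P m p
      (fun S => q ≤ (S ∩ Sstar i).card ∧ q ≤ (S ∩ Sstar j).card) {i, j}
    rw [card_pair hji.symm] at h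
    have hset : {ω : WConfig P m | Linked q P m Sstar ω i ∧ Linked q P m Sstar ω j} =
        {ω | (q ≤ (ω.1 ∩ Sstar i).card ∧ q ≤ (ω.1 ∩ Sstar j).card) ∧
          ∀ k ∈ ({i, j} : Finset (Fin m)), ω.2 k = true} := by
      ext ω
      simp only [Linked, Set.mem_ofPred_eq, mem_insert, mem_singleton, forall_eq_or_imp, forall_eq]
      tauto
    have hfilter : (powersetCard K univ).filter
        (fun S => q ≤ (S ∩ Sstar i).card ∧ q ≤ (S ∩ Sstar j).card) =
        (overlapRings q K (Sstar i)).filter fun S => q ≤ (S ∩ Sstar j).card := by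
      rw [overlapRings, filter_filter]
    have hboth := card_overlapRings_both_le q K hq hK (by omega) (Sstar i) (Sstar j) (hS i) (hS j)
    have hlow := sq_div_le_factorial_mul_rpow q K P hq hqK hKP
    rw [hset, h]
    calc _ ≤ (overlapRings q K (Sstar i)).card *
          ((Sstar i ∩ Sstar j).card / (K : ℝ) + (K : ℝ) ^ 2 / ((P : ℝ) - 2 * K) / q) /
            (P.choose K : ℝ) * p ^ 2 := by
          gcongr
          refine le_trans (le_of_eq ?_) hboth
          rw [← hfilter]
          congr!
      _ = psq q K P * p ^ 2 *
          ((Sstar i ∩ Sstar j).card / (K : ℝ) + (K : ℝ) ^ 2 / ((P : ℝ) - 2 * K) / q) := by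
          rw [hpsq]; ring
      _ ≤ psq q K P * p ^ 2 * ((Sstar i ∩ Sstar j).card / (K : ℝ) +
          ((q + 2).factorial : ℝ) * psq q K P ^ (1 / (q : ℝ))) := by gcongr
      _ = peq q K P p * (((q + 2).factorial : ℝ) * (p * psq q K P ^ (1 / (q : ℝ))) +
          p / K * (Sstar i ∩ Sstar j).card) := by
          rw [peq]; ring
      _ ≤ _ := by gcongr
  have hcount : ((univ.filter (fun j : Fin m => j ≠ i)).card : ℝ) ≤ m := by
    have := card_filter_le (univ : Finset (Fin m)) (fun j => j ≠ i)
    rw [card_univ, Fintype.card_fin] at this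
    exact_mod_cast this
  have hmain := wprob_sub_sum_le K P m h0.le h1 (fun j ω => Linked q P m Sstar ω j) i
  refine le_trans ?_ hmain
  have hsum := sum_le_sum hpair
  rw [← mul_sum, sum_add_distrib, sum_const, nsmul_eq_mul, ← mul_sum] at hsum
  have hR : 0 ≤ peq q K P p * (((q + 2).factorial : ℝ) * peq q K P p ^ (1 / (q : ℝ))) := by
    positivity
  have := mul_le_mul_of_nonneg_right hcount hR
  rw [hsingle]
  nlinarith

/-- with `K_n²/P_n → 0`, for all sufficiently large `n`,
uniformly over all choices of `K_n`-subsets `S_1*, …, S_m*` and every `i`,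
`P[w is linked to v_i and to no other v_j] ≥
  p_{e,q}·[1 − (q+2)!·m·p_{e,q}^{1/q} − (p_n/K_n)·Σ_{j≠i} |S_i* ∩ S_j*|]`. -/
theorem linked_only_i_prob_lower_bound
    (q m : ℕ) (hq : 1 ≤ q) (hm : 1 ≤ m)
    (K P : ℕ → ℕ) (p : ℕ → ℝ)
    (hK1 : ∀ n, 1 ≤ K n) (hKP : ∀ n, K n ≤ P n)
    (hp : ∀ n, p n ∈ Set.Ioc (0 : ℝ) 1)
    (hKsqP : Tendsto (fun n => ((K n : ℝ)) ^ 2 / (P n : ℝ)) atTop (nhds 0)) :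
    ∀ᶠ (n : ℕ) in atTop,
      ∀ Sstar : Fin m → Finset (Fin (P n)), (∀ i, (Sstar i).card = K n) →
        ∀ i : Fin m,
          peq q (K n) (P n) (p n) *
              (1 - (Nat.factorial (q + 2) : ℝ) * (m : ℝ) *
                    peq q (K n) (P n) (p n) ^ (1 / (q : ℝ))
                 - p n / (K n : ℝ) *
                    ∑ j ∈ Finset.univ.filter (fun j : Fin m => j ≠ i),
                      ((Sstar i ∩ Sstar j).card : ℝ))
            ≤ wprob (K n) (P n) m (p n)
                {ω | Linked q (P n) m Sstar ω i ∧
                  ∀ j : Fin m, j ≠ i → ¬ Linked q (P n) m Sstar ω j} := by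
  filter_upwards [hKsqP.eventually_le_const (by norm_num : (0 : ℝ) < 1 / 8)] with n hn Sstar hS i
  have hP : (0 : ℝ) < P n := by exact_mod_cast (hK1 n).trans (hKP n)
  rw [div_le_iff₀ hP] at hn
  have hlarge : 8 * K n ^ 2 ≤ P n := by
    have : 8 * (K n : ℝ) ^ 2 ≤ P n := by linarith
    exact_mod_cast this
  exact peq_mul_le_wprob q m (K n) (P n) (p n) hq (hK1 n) (hp n).1 (hp n).2 hlarge Sstar hS i
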